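/- For every measurable map 𝒜 : (X_space × {0,1})^T → H (an algorithm mapping T samples to a hypothesis), there exists τ ∈ {−1,1}^ν such that, when W = (Z_1, …, Z_T) is drawn from the product distribution Q^{(τ)} = Q_1^{(τ)} × ⋯ × Q_T^{(τ)}, the expected excess risk satisfies E_W[ Q_T^{(τ)}(L_{𝒜(W)}) − min_{h ∈ H} Q_T^{(τ)}(L_h) ] ≥ (7√6/768)·Φ*. -/

import Mathlib

open MeasureTheory

/-- The zero-one loss `L_h(x, y) = 1` if `y ≠ h(x)` and `0` otherwise. -/
noncomputable def lossB {X : Type*} (h : X → Bool) (z : X × Bool) : ℝ :=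
  if z.2 = h z.1 then 0 else 1

/-- The distribution on `Xs × {0,1}` whose `X`-marginal is uniform on the points
`X̄_1, …, X̄_ν` and with `Pr(Y = 1 | X = X̄_i) = p i`. -/
noncomputable def Qdist {Xs : Type*} [MeasurableSpace Xs] {ν : ℕ}
    (Xb : Fin ν → Xs) (p : Fin ν → ℝ) : Measure (Xs × Bool) :=
  (ν : ENNReal)⁻¹ • ∑ i : Fin ν,
    (ENNReal.ofReal (p i) • Measure.dirac (Xb i, true)
      + ENNReal.ofReal (1 - p i) • Measure.dirac (Xb i, false))

/-- The lower-bound construction `Q_t^{(τ)}`: uniform marginal on `X̄_1, …, X̄_ν`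
with `Pr(Y = 1 | X = X̄_i) = 1/2 + (τ_i/(16√6))·(√(ν/r̃) + Δ_{r̃} − Δ_{T−t+1})` for
`t > T − r̃` and `= 1/2` otherwise. -/
noncomputable def Qt {Xs : Type*} [MeasurableSpace Xs] {ν : ℕ}
    (Xb : Fin ν → Xs) (T : ℕ) (Δ : ℕ → ℝ) (rt : ℕ) (τ : Fin ν → Bool)
    (t : ℕ) : Measure (Xs × Bool) :=
  Qdist Xb (fun i => 1 / 2 + (if τ i then 1 else -1) / (16 * Real.sqrt 6) *
    (if T - rt < t then Real.sqrt (ν / rt) + Δ rt - Δ (T - t + 1) else 0))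

noncomputable def qw {ν : ℕ} (c : ℝ) (τ : Fin ν → Bool) (z : Fin ν × Bool) : ℝ :=
  (ν : ℝ)⁻¹ * (1 / 2 + (if τ z.1 = z.2 then c else -c))

noncomputable def Pw {ν T : ℕ} (c : Fin T → ℝ) (τ : Fin ν → Bool)
    (w : Fin T → Fin ν × Bool) : ℝ := ∏ t, qw (c t) τ (w t)

lemma qw_nonneg {ν : ℕ} {c : ℝ} (hc : c ^ 2 ≤ 2 / 9) (τ : Fin ν → Bool) (z) : 0 ≤ qw c τ z := by
  have h := abs_le_of_sq_le_sq' (a := c) (b := 1/2) (by norm_num; linarith) (by norm_num)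
  unfold qw
  apply mul_nonneg (by positivity)
  split_ifs <;> linarith [h.1, h.2]

lemma qw_sum {ν : ℕ} (hν : 1 ≤ ν) (c : ℝ) (τ : Fin ν → Bool) : ∑ z, qw c τ z = 1 := by
  rw [Fintype.sum_prod_type]
  have : ∀ i : Fin ν, ∑ y, qw c τ (i, y) = (ν : ℝ)⁻¹ := by
    intro i
    simp only [qw, Fintype.sum_bool]
    cases τ i <;> simp <;> ring
  simp only [this]
  have : (ν : ℝ) ≠ 0 := by positivity
  simp [this]

lemma Pw_sum {ν T : ℕ} (hν : 1 ≤ ν) (c : Fin T → ℝ) (τ : Fin ν → Bool) :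
    ∑ w, Pw c τ w = 1 := by
  unfold Pw
  rw [← Fintype.piFinset_univ, ← Finset.prod_univ_sum]
  simp [qw_sum hν]

def flipAt {ν : ℕ} (i : Fin ν) (τ : Fin ν → Bool) : Fin ν → Bool :=
  Function.update τ i (!τ i)

lemma flipAt_inv {ν : ℕ} (i : Fin ν) : Function.Involutive (flipAt i) := by
  intro τ
  simp [flipAt]

lemma bc_single {ν : ℕ} (hν : 1 ≤ ν) {c : ℝ} (hc : c ^ 2 ≤ 2 / 9) (τ : Fin ν → Bool)
    (i : Fin ν) :
    1 - 3 * c ^ 2 / ν ≤ ∑ z, Real.sqrt (qw c τ z * qw c (flipAt i τ) z) := by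
  have hν0 : (ν : ℝ) ≠ 0 := by positivity
  have key : ∀ j : Fin ν, (ν : ℝ)⁻¹ - (if j = i then 3 * c ^ 2 / ν else 0) ≤
      ∑ y, Real.sqrt (qw c τ (j, y) * qw c (flipAt i τ) (j, y)) := by
    intro j
    by_cases hj : j = i
    · subst hj
      have h1 : ∀ y, (ν : ℝ)⁻¹ * ((1 - 3 * c ^ 2) / 2) ≤
          Real.sqrt (qw c τ (j, y) * qw c (flipAt j τ) (j, y)) := by
        intro y
        apply Real.le_sqrt_of_sq_le
        have : qw c τ (j, y) * qw c (flipAt j τ) (j, y) = (ν : ℝ)⁻¹ ^ 2 * (1 / 4 - c ^ 2) := by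
          simp only [qw, flipAt, Function.update_self]
          cases τ j <;> cases y <;> simp <;> ring
        rw [this, mul_pow]
        apply mul_le_mul_of_nonneg_left _ (by positivity)
        nlinarith [sq_nonneg c]
      have := Finset.sum_le_sum (s := Finset.univ) (fun y _ => h1 y)
      refine le_trans (le_of_eq ?_) this
      simp
      field_simp
    · have : ∀ y, Real.sqrt (qw c τ (j, y) * qw c (flipAt i τ) (j, y)) = qw c τ (j, y) := by
        intro y
        have : qw c (flipAt i τ) (j, y) = qw c τ (j, y) := by
          simp [qw, flipAt, Function.update_of_ne hj]
        rw [this, Real.sqrt_mul_self (qw_nonneg hc _ _)]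
      simp only [this]
      simp only [qw, Fintype.sum_bool, hj]
      apply le_of_eq
      cases τ j <;> simp <;> ring
  rw [Fintype.sum_prod_type]
  refine le_trans (le_of_eq ?_) (Finset.sum_le_sum (s := Finset.univ) (fun j _ => key j))
  simp [Finset.sum_sub_distrib, hν0]

lemma prod_ge {T : ℕ} (s : Finset (Fin T)) (x : Fin T → ℝ) (h0 : ∀ t, 0 ≤ x t) (h1 : ∀ t, x t ≤ 1) :
    1 - ∑ t ∈ s, x t ≤ ∏ t ∈ s, (1 - x t) := by
  induction s using Finset.induction_on with
  | empty => simp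
  | insert a s ha ih =>
    rw [Finset.sum_insert ha, Finset.prod_insert ha]
    have : 0 ≤ ∑ t ∈ s, x t := Finset.sum_nonneg fun t _ => h0 t
    nlinarith [h0 a, h1 a, mul_le_mul_of_nonneg_left ih (sub_nonneg.2 (h1 a)), mul_nonneg (h0 a) this]

lemma Pw_nonneg {ν T : ℕ} {c : Fin T → ℝ} (hc : ∀ t, c t ^ 2 ≤ 2 / 9) (τ : Fin ν → Bool) (w) :
    0 ≤ Pw c τ w := Finset.prod_nonneg fun t _ => qw_nonneg (hc t) _ _

lemma min_sum {ν T : ℕ} (hν : 1 ≤ ν) {c : Fin T → ℝ} (hc : ∀ t, c t ^ 2 ≤ 2 / 9)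
    (hs : ∑ t, 3 * c t ^ 2 / ν ≤ 1 / 128) (τ : Fin ν → Bool) (i : Fin ν) :
    7 / 8 ≤ ∑ w, min (Pw c τ w) (Pw c (flipAt i τ) w) := by
  have hν1 : (1 : ℝ) ≤ ν := by exact_mod_cast hν
  set P := Pw c τ
  set Q := Pw c (flipAt i τ)
  have hP : ∀ w, 0 ≤ P w := Pw_nonneg hc _
  have hQ : ∀ w, 0 ≤ Q w := Pw_nonneg hc _
  have hbc : 1 - 1 / 128 ≤ ∑ w, Real.sqrt (P w * Q w) := by
    have e : ∑ w, Real.sqrt (P w * Q w) =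
        ∏ t, ∑ z, Real.sqrt (qw (c t) τ z * qw (c t) (flipAt i τ) z) := by
      rw [Finset.prod_univ_sum, Fintype.piFinset_univ]
      refine Finset.sum_congr rfl fun w _ => ?_
      simp only [P, Q, Pw]
      rw [← Finset.prod_mul_distrib, Real.sqrt_prod]
      intro t _
      exact mul_nonneg (qw_nonneg (hc t) _ _) (qw_nonneg (hc t) _ _)
    rw [e]
    have hx1 : ∀ t, 3 * c t ^ 2 / ν ≤ 1 := by
      intro t
      rw [div_le_one (by linarith)]
      linarith [hc t]
    calc (1 : ℝ) - 1 / 128 ≤ 1 - ∑ t, 3 * c t ^ 2 / ν := by linarith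
      _ ≤ ∏ t, (1 - 3 * c t ^ 2 / ν) := prod_ge _ _ (fun t => by positivity) hx1
      _ ≤ _ := Finset.prod_le_prod (fun t _ => by linarith [hx1 t])
          (fun t _ => bc_single hν (hc t) τ i)
  set m := ∑ w, min (P w) (Q w) with hm
  have hM : ∑ w, max (P w) (Q w) = 2 - m := by
    have : ∑ w, max (P w) (Q w) + m = 2 := by
      rw [hm, ← Finset.sum_add_distrib]
      simp only [max_add_min, Finset.sum_add_distrib, P, Q, Pw_sum hν]
      norm_num
    linarith
  have cs : (∑ w, Real.sqrt (P w * Q w)) ^ 2 ≤ m * (2 - m) := by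
    rw [← hM, hm]
    have := Finset.sum_mul_sq_le_sq_mul_sq Finset.univ
      (fun w => Real.sqrt (min (P w) (Q w))) (fun w => Real.sqrt (max (P w) (Q w)))
    have e1 : ∀ w, Real.sqrt (min (P w) (Q w)) ^ 2 = min (P w) (Q w) :=
      fun w => Real.sq_sqrt (le_min (hP w) (hQ w))
    have e2 : ∀ w, Real.sqrt (max (P w) (Q w)) ^ 2 = max (P w) (Q w) :=
      fun w => Real.sq_sqrt (le_max_of_le_left (hP w))
    have e3 : ∀ w, Real.sqrt (min (P w) (Q w)) * Real.sqrt (max (P w) (Q w))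
        = Real.sqrt (P w * Q w) := fun w => by
      rw [← Real.sqrt_mul (le_min (hP w) (hQ w)), min_mul_max]
    simpa only [e1, e2, e3] using this
  have : (1 - m) ^ 2 ≤ (1 / 8) ^ 2 := by nlinarith
  have := abs_le_of_sq_le_sq' this (by norm_num)
  linarith [this.2]

lemma finite_lb {ν T : ℕ} (hν : 1 ≤ ν) {c : Fin T → ℝ} (hc : ∀ t, c t ^ 2 ≤ 2 / 9)
    (hs : ∑ t, 3 * c t ^ 2 / ν ≤ 1 / 128)
    (g : (Fin T → Fin ν × Bool) → Fin ν → Bool) :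
    ∃ τ : Fin ν → Bool,
      7 / 16 * (ν : ℝ) ≤ ∑ w, Pw c τ w * ∑ i, (if g w i = τ i then 0 else 1 : ℝ) := by
  have key : ∀ i : Fin ν, ∑ τ : Fin ν → Bool, (7 / 16 : ℝ) ≤
      ∑ τ : Fin ν → Bool, ∑ w, Pw c τ w * (if g w i = τ i then 0 else 1 : ℝ) := by
    intro i
    set F : (Fin ν → Bool) → ℝ := fun τ => ∑ w, Pw c τ w * (if g w i = τ i then 0 else 1 : ℝ)
    have h1 : ∑ τ, F (flipAt i τ) = ∑ τ, F τ :=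
      Equiv.sum_comp ((flipAt_inv i).toPerm) F
    have h2 : ∑ τ : Fin ν → Bool, (7 / 8 : ℝ) ≤ ∑ τ, (F τ + F (flipAt i τ)) := by
      refine Finset.sum_le_sum fun τ _ => (min_sum hν hc hs τ i).trans ?_
      simp only [F]
      rw [← Finset.sum_add_distrib]
      refine Finset.sum_le_sum fun w _ => ?_
      have : flipAt i τ i = !τ i := by simp [flipAt]
      rw [this]
      cases g w i <;> cases τ i <;> simp
    rw [Finset.sum_add_distrib, h1] at h2
    have h3 : ∑ τ : Fin ν → Bool, (7 / 8 : ℝ) = 2 * ∑ τ : Fin ν → Bool, (7 / 16 : ℝ) := by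
      rw [Finset.mul_sum]; norm_num
    show _ ≤ ∑ τ, F τ
    linarith
  have := Finset.sum_le_sum (s := Finset.univ) (fun i _ => key i)
  have h2 : ∑ τ : Fin ν → Bool, 7 / 16 * (ν : ℝ) ≤ ∑ τ : Fin ν → Bool,
      ∑ w, Pw c τ w * ∑ i, (if g w i = τ i then 0 else 1 : ℝ) := by
    refine le_trans (le_of_eq ?_) (this.trans (le_of_eq ?_))
    · rw [Finset.sum_comm]; simp; ring
    · rw [Finset.sum_comm]
      refine Finset.sum_congr rfl fun τ _ => ?_
      rw [Finset.sum_comm]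
      simp only [Finset.mul_sum]
  obtain ⟨τ, -, h⟩ := Finset.exists_le_of_sum_le Finset.univ_nonempty h2
  exact ⟨τ, h⟩

section meas
variable {Xs : Type*} [MeasurableSpace Xs] [MeasurableSingletonClass Xs] {ν : ℕ}

def emb (Xb : Fin ν → Xs) (z : Fin ν × Bool) : Xs × Bool := (Xb z.1, z.2)

lemma Qdist_eq (hν : 1 ≤ ν) (Xb : Fin ν → Xs) (p : Fin ν → ℝ) (c : ℝ) (τ : Fin ν → Bool)
    (hp : ∀ i, p i = 1 / 2 + if τ i then c else -c) :
    Qdist Xb p = ∑ z, ENNReal.ofReal (qw c τ z) • Measure.dirac (emb Xb z) := by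
  have hν0 : (0 : ℝ) < ν := by positivity
  have e : (ν : ENNReal)⁻¹ = ENNReal.ofReal ((ν : ℝ)⁻¹) := by
    rw [ENNReal.ofReal_inv_of_pos hν0, ENNReal.ofReal_natCast]
  unfold Qdist
  rw [Fintype.sum_prod_type, Finset.smul_sum]
  refine Finset.sum_congr rfl fun i _ => ?_
  simp only [Fintype.sum_bool, smul_add, smul_smul, emb, qw, e]
  rw [← ENNReal.ofReal_mul (by positivity), ← ENNReal.ofReal_mul (by positivity), hp]
  cases τ i
  · simp; congr 4; ring
  · simp; congr 4; ring

lemma integral_sum_dirac {α β : Type*} [MeasurableSpace α] [MeasurableSingletonClass α] [Fintype β]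
    (q : β → ℝ) (hq : ∀ b, 0 ≤ q b) (e : β → α) (f : α → ℝ) :
    ∫ x, f x ∂(∑ b, ENNReal.ofReal (q b) • Measure.dirac (e b)) = ∑ b, q b * f (e b) := by
  rw [integral_finsetSum_measure]
  · refine Finset.sum_congr rfl fun b _ => ?_
    rw [integral_smul_measure, integral_dirac, ENNReal.toReal_ofReal (hq b), smul_eq_mul]
  · intro b _
    exact (integrable_dirac (by simp)).smul_measure (by simp)

lemma pi_sum_dirac {α β : Type*} [MeasurableSpace α] [Fintype β] {T : ℕ}
    (q : Fin T → β → ℝ) (hq : ∀ t b, 0 ≤ q t b) (e : β → α) :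
    Measure.pi (fun t => ∑ b, ENNReal.ofReal (q t b) • Measure.dirac (e b)) =
      ∑ w : Fin T → β, ENNReal.ofReal (∏ t, q t (w t)) • Measure.dirac (fun t => e (w t)) := by
  classical
  have : ∀ t, IsFiniteMeasure (∑ b, ENNReal.ofReal (q t b) • Measure.dirac (e b)) := by
    intro t
    refine ⟨?_⟩
    simp [Measure.finsetSum_apply, ENNReal.sum_lt_top]
  refine Measure.pi_eq fun s hs => ?_
  simp only [Measure.finsetSum_apply, Measure.smul_apply, smul_eq_mul]
  rw [Finset.prod_univ_sum, Fintype.piFinset_univ]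
  refine Finset.sum_congr rfl fun w _ => ?_
  rw [Finset.prod_mul_distrib, ENNReal.ofReal_prod_of_nonneg (fun t _ => hq _ _)]
  congr 1
  rw [Measure.dirac_apply' _ (MeasurableSet.univ_pi hs)]
  simp only [Measure.dirac_apply' _ (hs _), Set.indicator_apply, Set.mem_univ_pi, Pi.one_apply]
  by_cases h : ∀ t, e (w t) ∈ s t
  · simp [h]
  · rw [if_neg h]
    push Not at h
    obtain ⟨t, ht⟩ := h
    exact (Finset.prod_eq_zero (Finset.mem_univ t) (by simp [ht])).symm

lemma risk_eq (hν : 1 ≤ ν) (c : ℝ) (τ : Fin ν → Bool) (Xb : Fin ν → Xs) (h : Xs → Bool) :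
    ∑ z, qw c τ z * lossB h (emb Xb z) =
      1 / 2 - c + 2 * c / ν * ∑ i, (if h (Xb i) = τ i then 0 else 1 : ℝ) := by
  have hν0 : (ν : ℝ) ≠ 0 := by positivity
  rw [Fintype.sum_prod_type]
  have : ∀ i, ∑ y, qw c τ (i, y) * lossB h (emb Xb (i, y)) =
     (ν : ℝ)⁻¹ * (1 / 2 - c) + 2 * c / ν * (if h (Xb i) = τ i then 0 else 1 : ℝ) := by
    intro i
    simp only [Fintype.sum_bool, qw, lossB, emb]
    rcases Bool.eq_false_or_eq_true (h (Xb i)) with hh | hh <;>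
      rcases Bool.eq_false_or_eq_true (τ i) with ht | ht <;> simp [hh, ht, -mul_eq_mul_left_iff] <;> ring
  simp only [this, Finset.sum_add_distrib, ← Finset.mul_sum]
  simp
  field_simp
end meas

/-- lower bound for the constructed family. For every measurable
algorithm `𝒜` there is a `τ` such that the expected excess risk of `𝒜` on data
drawn from `Q_1^{(τ)} × ⋯ × Q_T^{(τ)}` is at least `(7√6/768)·Φ*`. -/
theorem stmt17 {Xs : Type*} [MeasurableSpace Xs] [MeasurableSingletonClass Xs]
    {ι : Type*} [MeasurableSpace ι] [Nonempty ι] (H : ι → Xs → Bool)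
    (ν : ℕ) (hν : 1 ≤ ν) (Xb : Fin ν → Xs) (hXbinj : Function.Injective Xb)
    (hshatter : ∀ b : Fin ν → Bool, ∃ h, ∀ i, H h (Xb i) = b i)
    (T : ℕ) (hT : 1 ≤ T) (Δ : ℕ → ℝ)
    (hΔ0 : ∀ r, 0 ≤ Δ r) (hΔ1 : Δ 1 = 0)
    (hΔmono : ∀ r s, 1 ≤ r → r ≤ s → s ≤ T → Δ r ≤ Δ s)
    (hΦ : (Finset.Icc 1 T).inf' (Finset.nonempty_Icc.mpr hT)
      (fun r => Real.sqrt (ν / r) + Δ r) < 1 / 3)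
    (rt : ℕ) (hrt1 : 1 ≤ rt) (hrtT : rt ≤ T)
    (hrtlt : Δ rt < Real.sqrt (ν / rt))
    (hrtmax : ∀ r, 1 ≤ r → r ≤ T → Δ r < Real.sqrt (ν / r) → r ≤ rt)
    (A : (Fin T → Xs × Bool) → ι) (hA : Measurable A) :
    ∃ τ : Fin ν → Bool,
      7 * Real.sqrt 6 / 768 *
        (Finset.Icc 1 T).inf' (Finset.nonempty_Icc.mpr hT)
          (fun r => Real.sqrt (ν / r) + Δ r)
      ≤ ∫ w, ((∫ z, lossB (H (A w)) z ∂(Qt Xb T Δ rt τ T))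
            - ⨅ h : ι, ∫ z, lossB (H h) z ∂(Qt Xb T Δ rt τ T))
          ∂(Measure.pi fun t : Fin T => Qt Xb T Δ rt τ ((t : ℕ) + 1)) := by
  set Φs := (Finset.Icc 1 T).inf' (Finset.nonempty_Icc.mpr hT)
          (fun r => Real.sqrt (ν / r) + Δ r) with hΦs
  set S := Real.sqrt ((ν : ℝ) / rt) with hS
  have hν0 : (0 : ℝ) < ν := by positivity
  have hrt0 : (0 : ℝ) < rt := by positivity
  have hS0 : 0 ≤ S := Real.sqrt_nonneg _
  have hS2 : S ^ 2 = ν / rt := Real.sq_sqrt (by positivity)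
  have h6 : Real.sqrt 6 ^ 2 = 6 := Real.sq_sqrt (by norm_num)
  have h60 : 0 < Real.sqrt 6 := by positivity
  have hΦle : Φs ≤ S + Δ rt :=
    Finset.inf'_le (fun r : ℕ => Real.sqrt ((ν : ℝ) / r) + Δ r) (Finset.mem_Icc.2 ⟨hrt1, hrtT⟩)
  -- bound on S
  have hSle : S ^ 2 ≤ 2 / 9 := by
    obtain ⟨r, hr, hre⟩ := Finset.exists_mem_eq_inf' (Finset.nonempty_Icc.mpr hT)
      (fun r : ℕ => Real.sqrt ((ν : ℝ) / r) + Δ r)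
    rw [← hΦs] at hre
    obtain ⟨hr1, hrT⟩ := Finset.mem_Icc.1 hr
    have hr0 : (0 : ℝ) < r := by positivity
    have hq := Real.sqrt_nonneg ((ν : ℝ) / r)
    by_cases hle : r ≤ rt
    · have h1 : Real.sqrt ((ν : ℝ) / r) ^ 2 = ν / r := Real.sq_sqrt (by positivity)
      have h2 : Real.sqrt ((ν : ℝ) / r) < 1 / 3 := by linarith [hΔ0 r]
      have h3 : (ν : ℝ) / rt ≤ ν / r := by
        apply div_le_div_of_nonneg_left hν0.le hr0
        exact_mod_cast hle
      rw [hS2]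
      nlinarith
    · have h1 : rt + 1 ≤ r := by omega
      have h2 : Real.sqrt ((ν : ℝ) / ((rt + 1 : ℕ) : ℝ)) ≤ Δ (rt + 1) := by
        by_contra hcon
        have := hrtmax (rt + 1) (by omega) (by omega) (not_le.1 hcon)
        omega
      have h3 := hΔmono (rt + 1) r (by omega) h1 hrT
      have h4 : Real.sqrt ((ν : ℝ) / ((rt + 1 : ℕ) : ℝ)) < 1 / 3 := by linarith
      have h5 : Real.sqrt ((ν : ℝ) / ((rt + 1 : ℕ) : ℝ)) ^ 2 = (ν : ℝ) / ((rt + 1 : ℕ) : ℝ) :=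
        Real.sq_sqrt (by positivity)
      have h6 := Real.sqrt_nonneg ((ν : ℝ) / ((rt + 1 : ℕ) : ℝ))
      have h7 : (ν : ℝ) / ((rt + 1 : ℕ) : ℝ) ≤ 1 / 9 := by nlinarith
      rw [div_le_iff₀ (by positivity)] at h7
      rw [hS2, div_le_iff₀ hrt0]
      push_cast at h7
      have : (1 : ℝ) ≤ rt := by exact_mod_cast hrt1
      linarith
  set D : ℕ → ℝ := fun t => if T - rt < t then S + Δ rt - Δ (T - t + 1) else 0 with hD
  set c : ℕ → ℝ := fun t => D t / (16 * Real.sqrt 6) with hcdef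
  have hD2 : ∀ t, 1 ≤ t → t ≤ T → D t ^ 2 ≤ if T - rt < t then 4 * S ^ 2 else 0 := by
    intro t ht1 htT
    simp only [hD]
    split_ifs with h
    · have h1 := hΔmono (T - t + 1) rt (by omega) (by omega) hrtT
      have h2 := hΔ0 (T - t + 1)
      nlinarith
    · simp
  have hc2e : ∀ t, c t ^ 2 = D t ^ 2 / 1536 := by
    intro t
    simp only [hcdef, div_pow, mul_pow, h6]
    norm_num
  have hc2 : ∀ t : Fin T, c ((t : ℕ) + 1) ^ 2 ≤ 2 / 9 := by
    intro t
    have := hD2 (t + 1) (by omega) (by omega)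
    rw [hc2e]
    split_ifs at this <;> linarith
  have hcT : c T ^ 2 ≤ 2 / 9 := by
    have := hD2 T hT le_rfl
    rw [hc2e]
    split_ifs at this <;> linarith
  have hsum : ∑ t : Fin T, 3 * c ((t : ℕ) + 1) ^ 2 / ν ≤ 1 / 128 := by
    have h1 : ∀ t : Fin T, 3 * c ((t : ℕ) + 1) ^ 2 / ν ≤
        if T - rt < (t : ℕ) + 1 then 1 / (128 * (rt : ℝ)) else 0 := by
      intro t
      have := hD2 (t + 1) (by omega) (by omega)
      rw [hc2e]
      split_ifs at this ⊢
      · rw [hS2] at this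
        rw [div_le_iff₀ hν0]
        calc 3 * (D (t + 1) ^ 2 / 1536) ≤ 3 * (4 * (ν / rt) / 1536) := by linarith
          _ = 1 / (128 * (rt : ℝ)) * ν := by field_simp; norm_num
      · rw [div_le_iff₀ hν0]; linarith
    refine (Finset.sum_le_sum fun t _ => h1 t).trans ?_
    rw [Fin.sum_univ_eq_sum_range
      (fun t : ℕ => if T - rt < t + 1 then 1 / (128 * (rt : ℝ)) else 0) T]
    rw [← Finset.sum_filter, Finset.sum_const, nsmul_eq_mul]
    have hcard : ((Finset.range T).filter fun t => T - rt < t + 1).card = rt := by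
      have : (Finset.range T).filter (fun t => T - rt < t + 1) = Finset.Ico (T - rt) T := by
        ext t; simp only [Finset.mem_filter, Finset.mem_range, Finset.mem_Ico]; omega
      rw [this, Nat.card_Ico]; omega
    rw [hcard]
    apply le_of_eq
    field_simp
  have hcTe : c T = (S + Δ rt) / (16 * Real.sqrt 6) := by
    have h1 : T - rt < T := by omega
    simp [hcdef, hD, h1, hΔ1]
  have hcT0 : 0 ≤ c T := by
    rw [hcTe]
    have := hΔ0 rt
    positivity
  have hQ : ∀ τ t, Qt Xb T Δ rt τ t =
      ∑ z, ENNReal.ofReal (qw (c t) τ z) • Measure.dirac (emb Xb z) := by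
    intro τ t
    unfold Qt
    apply Qdist_eq hν
    intro i
    show 1 / 2 + (if τ i then 1 else -1) / (16 * Real.sqrt 6) * D t =
      1 / 2 + if τ i then D t / (16 * Real.sqrt 6) else -(D t / (16 * Real.sqrt 6))
    split_ifs <;> ring
  have hrisk : ∀ τ (h : Xs → Bool), ∫ z, lossB h z ∂(Qt Xb T Δ rt τ T) =
      1 / 2 - c T + 2 * c T / ν * ∑ i, (if h (Xb i) = τ i then 0 else 1 : ℝ) := by
    intro τ h
    rw [hQ, integral_sum_dirac _ (fun z => qw_nonneg hcT _ _), risk_eq hν]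
  have hpi : ∀ τ, (Measure.pi fun t : Fin T => Qt Xb T Δ rt τ ((t : ℕ) + 1)) =
      ∑ w : Fin T → Fin ν × Bool,
        ENNReal.ofReal (Pw (fun t : Fin T => c ((t : ℕ) + 1)) τ w) •
          Measure.dirac (fun t => emb Xb (w t)) := by
    intro τ
    simp only [hQ]
    exact pi_sum_dirac (fun t : Fin T => qw (c ((t : ℕ) + 1)) τ)
      (fun t b => qw_nonneg (hc2 t) _ _) (emb Xb)
  obtain ⟨τ, hτ⟩ := finite_lb hν hc2 hsum
    (fun w i => H (A (fun t => emb Xb (w t))) (Xb i))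
  refine ⟨τ, ?_⟩
  rw [hpi, integral_sum_dirac _ (fun w => Pw_nonneg hc2 _ _)]
  have hinf : ⨅ h : ι, ∫ z, lossB (H h) z ∂(Qt Xb T Δ rt τ T) ≤ 1 / 2 - c T := by
    obtain ⟨h, hh⟩ := hshatter τ
    refine (ciInf_le ⟨0, ?_⟩ h).trans (le_of_eq ?_)
    · rintro _ ⟨h, rfl⟩
      refine integral_nonneg fun z => ?_
      simp only [lossB]
      split_ifs <;> simp
    · rw [hrisk]; simp [hh]
  have hge : ∑ w : Fin T → Fin ν × Bool, Pw (fun t : Fin T => c ((t : ℕ) + 1)) τ w *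
      (2 * c T / ν * ∑ i, (if H (A (fun t => emb Xb (w t))) (Xb i) = τ i then 0 else 1 : ℝ)) ≤
      ∑ w : Fin T → Fin ν × Bool, Pw (fun t : Fin T => c ((t : ℕ) + 1)) τ w *
      ((∫ z, lossB (H (A (fun t => emb Xb (w t)))) z ∂(Qt Xb T Δ rt τ T))
            - ⨅ h : ι, ∫ z, lossB (H h) z ∂(Qt Xb T Δ rt τ T)) := by
    refine Finset.sum_le_sum fun w _ => mul_le_mul_of_nonneg_left ?_ (Pw_nonneg hc2 _ _)
    rw [hrisk τ (H (A (fun t => emb Xb (w t))))]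
    linarith
  refine le_trans ?_ hge
  have hfac : ∑ w : Fin T → Fin ν × Bool, Pw (fun t : Fin T => c ((t : ℕ) + 1)) τ w *
      (2 * c T / ν * ∑ i, (if H (A (fun t => emb Xb (w t))) (Xb i) = τ i then 0 else 1 : ℝ)) =
      2 * c T / ν * ∑ w : Fin T → Fin ν × Bool, Pw (fun t : Fin T => c ((t : ℕ) + 1)) τ w *
       ∑ i, (if H (A (fun t => emb Xb (w t))) (Xb i) = τ i then 0 else 1 : ℝ) := by
    rw [Finset.mul_sum]
    exact Finset.sum_congr rfl fun w _ => by ring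
  rw [hfac]
  refine le_trans ?_ (mul_le_mul_of_nonneg_left hτ (by positivity))
  have e1 : 2 * c T / ν * (7 / 16 * (ν : ℝ)) = 7 * Real.sqrt 6 / 768 * (S + Δ rt) := by
    rw [hcTe]
    field_simp
    rw [h6]
    ring
  rw [e1]
  exact mul_le_mul_of_nonneg_left hΦle (by positivity)
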